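/- Suppose C and K are two compact linear operators on a separable Hilbert space H with singular value decompositions C(x) = Σ_{j=1}^∞ λ_j ⟨x, v_j⟩ f_j and K(x) = Σ_{j=1}^∞ γ_j ⟨x, u_j⟩ g_j. Assume C is Hilbert–Schmidt, symmetric and positive definite (so that f_j = v_j and C(v_j) = λ_j v_j), and that its eigenvalues satisfy λ_1 > λ_2 > ⋯ > λ_d > λ_{d+1}. Set v_j′ = ĉ_j v_j with ĉ_j = sign(⟨u_j, v_j⟩). Then, for 1 ≤ j ≤ d, ‖u_j − v_j′‖ ≤ (2√2 / α_j) ‖K − C‖_L, where α_1 = λ_1 − λ_2 and α_j = min(λ_{j−1} − λ_j, λ_j − λ_{j+1}) for 2 ≤ j ≤ d. -/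

import Mathlib

open MeasureTheory Filter
open scoped ENNReal RealInnerProductSpace

/-- If `A` has singular values `s`, right singular vectors `w` and left singular vectors `f`,
then `A x` has `f`-coordinates `s i * ⟪x, w i⟫`. -/
lemma inner_apply_of_svd {H : Type*} [NormedAddCommGroup H] [InnerProductSpace ℝ H]
    {A : H →L[ℝ] H} {s : ℕ → ℝ} {w f : ℕ → H} (hf : Orthonormal ℝ f)
    (hA : ∀ x, HasSum (fun j => (s j * ⟪x, w j⟫) • f j) (A x)) (x : H) (i : ℕ) :
    ⟪A x, f i⟫ = s i * ⟪x, w i⟫ := by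
  have h := (hA x).mapL (innerSL ℝ (f i))
  have h2 := hasSum_single (f := fun j => innerSL ℝ (f i) ((s j * ⟪x, w j⟫) • f j)) i
    (fun j hj => by simp [hf.inner_eq_zero hj.symm])
  have h3 := h.unique h2
  simp only [innerSL_apply_apply, inner_smul_right, real_inner_self_eq_norm_sq, hf.1 i] at h3
  rw [real_inner_comm, h3]
  ring

lemma hasSum_norm_sq_of_svd {H : Type*} [NormedAddCommGroup H] [InnerProductSpace ℝ H]
    {A : H →L[ℝ] H} {s : ℕ → ℝ} {w f : ℕ → H} (hf : Orthonormal ℝ f)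
    (hA : ∀ x, HasSum (fun j => (s j * ⟪x, w j⟫) • f j) (A x)) (x : H) :
    HasSum (fun i => s i ^ 2 * ⟪x, w i⟫ ^ 2) (‖A x‖ ^ 2) := by
  have h := (hA x).mapL (innerSL ℝ (A x))
  simp only [innerSL_apply_apply, inner_smul_right, inner_apply_of_svd hf hA,
    real_inner_self_eq_norm_sq] at h
  exact h.congr_fun fun i => by ring

lemma apply_right_singular_vector {H : Type*} [NormedAddCommGroup H] [InnerProductSpace ℝ H]
    {A : H →L[ℝ] H} {s : ℕ → ℝ} {w f : ℕ → H} (hw : Orthonormal ℝ w)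
    (hA : ∀ x, HasSum (fun j => (s j * ⟪x, w j⟫) • f j) (A x)) (i : ℕ) :
    A (w i) = s i • f i := by
  have h2 := hasSum_single (f := fun j => (s j * ⟪w i, w j⟫) • f j) i
    (fun j hj => by simp [hw.inner_eq_zero hj.symm])
  have h3 := (hA (w i)).unique h2
  simpa [real_inner_self_eq_norm_sq, hw.1 i] using h3

/-- Weyl's inequality for singular values. -/
lemma singular_value_le_add_norm_sub {H : Type*} [NormedAddCommGroup H] [InnerProductSpace ℝ H]
    {A B : H →L[ℝ] H} {s t : ℕ → ℝ} {w f z k : ℕ → H}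
    (hs0 : ∀ j, 0 ≤ s j) (ht0 : ∀ j, 0 ≤ t j) (hs : Antitone s) (ht : Antitone t)
    (hw : Orthonormal ℝ w) (hf : Orthonormal ℝ f) (hz : Orthonormal ℝ z) (hk : Orthonormal ℝ k)
    (hA : ∀ x, HasSum (fun j => (s j * ⟪x, w j⟫) • f j) (A x))
    (hB : ∀ x, HasSum (fun j => (t j * ⟪x, z j⟫) • k j) (B x)) (j : ℕ) :
    t j ≤ s j + ‖A - B‖ := by
  let X : (Fin (j + 1) → ℝ) →ₗ[ℝ] H := Fintype.linearCombination ℝ (fun i : Fin (j + 1) => z i)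
  let L : (Fin (j + 1) → ℝ) →ₗ[ℝ] (Fin j → ℝ) :=
    LinearMap.pi (fun i : Fin j => (innerSL ℝ (w i)).toLinearMap ∘ₗ X)
  have hker : LinearMap.ker L ≠ ⊥ := LinearMap.ker_ne_bot_of_finrank_lt (by simp)
  obtain ⟨c, hc, hc0⟩ := (Submodule.ne_bot_iff _).1 hker
  have hzF : Orthonormal ℝ (fun i : Fin (j + 1) => z i) := hz.comp _ Fin.val_injective
  have hX : X c = ∑ i, c i • z i := by simp [X, Fintype.linearCombination_apply]
  have hperp : ∀ i < j, ⟪X c, w i⟫ = 0 := fun i hi => by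
    have := congrFun (LinearMap.mem_ker.1 hc) ⟨i, hi⟩
    rw [real_inner_comm]
    simpa [L] using this
  have hcoord : ∀ i : Fin (j + 1), ⟪X c, z i⟫ = c i := fun i => by
    rw [hX, real_inner_comm]
    exact hzF.inner_right_fintype c i
  have hnorm : ‖X c‖ ^ 2 = ∑ i, c i ^ 2 := by
    rw [← real_inner_self_eq_norm_sq]
    nth_rewrite 2 [hX]
    simp [inner_sum, inner_smul_right, hcoord, sq]
  have hpos : 0 < ‖X c‖ := by
    obtain ⟨i, hi⟩ := Function.ne_iff.1 hc0
    rw [norm_pos_iff]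
    intro h
    exact hi (by simpa [h] using (hcoord i).symm)
  have hAx : ‖A (X c)‖ ≤ s j * ‖X c‖ := by
    apply le_of_sq_le_sq _ (mul_nonneg (hs0 j) hpos.le)
    have hbs : Summable fun i => ⟪X c, w i⟫ ^ 2 := by
      simpa [real_inner_comm] using hw.inner_products_summable (x := X c)
    have hbt : ∑' i, ⟪X c, w i⟫ ^ 2 ≤ ‖X c‖ ^ 2 := by
      simpa [real_inner_comm] using hw.tsum_inner_products_le (x := X c)
    calc ‖A (X c)‖ ^ 2 ≤ s j ^ 2 * ∑' i, ⟪X c, w i⟫ ^ 2 := by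
          refine hasSum_le (fun i => ?_) (hasSum_norm_sq_of_svd hf hA (X c))
            (hbs.hasSum.mul_left _)
          rcases lt_or_ge i j with hi | hi
          · simp [hperp i hi]
          · have := hs0 i
            have := hs hi
            gcongr
      _ ≤ s j ^ 2 * ‖X c‖ ^ 2 := by gcongr
      _ = (s j * ‖X c‖) ^ 2 := by ring
  have hBx : t j * ‖X c‖ ≤ ‖B (X c)‖ := by
    apply le_of_sq_le_sq _ (norm_nonneg _)
    calc (t j * ‖X c‖) ^ 2 = ∑ i : Fin (j + 1), t j ^ 2 * c i ^ 2 := by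
          rw [mul_pow, hnorm, Finset.mul_sum]
      _ ≤ ∑ i : Fin (j + 1), t i ^ 2 * ⟪X c, z i⟫ ^ 2 := by
          refine Finset.sum_le_sum fun i _ => ?_
          rw [hcoord]
          have := ht0 j
          have := ht (Nat.lt_succ_iff.1 i.2)
          gcongr
      _ = ∑ i ∈ Finset.range (j + 1), t i ^ 2 * ⟪X c, z i⟫ ^ 2 :=
          Fin.sum_univ_eq_sum_range (fun i => t i ^ 2 * ⟪X c, z i⟫ ^ 2) (j + 1)
      _ ≤ ‖B (X c)‖ ^ 2 :=
          sum_le_hasSum _ (fun i _ => by positivity) (hasSum_norm_sq_of_svd hk hB (X c))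
  have hsub : ‖B (X c)‖ ≤ ‖A (X c)‖ + ‖A - B‖ * ‖X c‖ := by
    have h1 : ‖B (X c)‖ ≤ ‖A (X c)‖ + ‖(A - B) (X c)‖ := by
      have := norm_sub_le (A (X c)) ((A - B) (X c))
      simpa using this
    linarith [(A - B).le_opNorm (X c)]
  exact le_of_mul_le_mul_right (by linarith) hpos

lemma norm_sub_sign_smul_sq_le {H : Type*} [NormedAddCommGroup H] [InnerProductSpace ℝ H]
    {x y : H} (hx : ‖x‖ = 1) (hy : ‖y‖ = 1) :
    ‖x - Real.sign ⟪x, y⟫ • y‖ ^ 2 ≤ 2 - 2 * |⟪x, y⟫| := by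
  rw [norm_sub_sq_real, inner_smul_right, norm_smul, hx, hy]
  rcases lt_trichotomy ⟪x, y⟫ 0 with h | h | h
  · rw [Real.sign_of_neg h, abs_of_neg h]; norm_num; linarith
  · rw [h]; simp
  · rw [Real.sign_of_pos h, abs_of_pos h]; norm_num; linarith

lemma sq_dist_mul_le_residuals {l r a b m : ℝ} (hl : 0 ≤ l) (hr : 0 ≤ r) (hm : 0 ≤ m)
    (h : m ≤ |l - r|) :
    m ^ 2 * (a ^ 2 + b ^ 2) ≤ (l * b - r * a) ^ 2 + (l * a - r * b) ^ 2 := by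
  have h1 : m ^ 2 ≤ (l - r) ^ 2 := by
    rw [← sq_abs (l - r)]
    gcongr
  have h2 : (l - r) ^ 2 * (a ^ 2 + b ^ 2) ≤ (l * b - r * a) ^ 2 + (l * a - r * b) ^ 2 := by
    nlinarith [mul_nonneg (mul_nonneg hl hr) (sq_nonneg (a - b))]
  exact le_trans (by gcongr) h2

/-- A scalar inequality behind the `sin 2θ` bound: `a` and `b` are cosines, `h` is the shift of
the singular value, `e` the size of the perturbation and `α` the gap. -/
lemma one_sub_le_of_gap_bound {α e h a b : ℝ} (hα : 0 < α) (hhα : 2 * h ≤ α)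
    (ha : |a| ≤ 1) (hb : |b| ≤ 1)
    (hsum : (α - h) ^ 2 * 2 + (h ^ 2 - (α - h) ^ 2) * (a ^ 2 + b ^ 2) ≤ 2 * e ^ 2) :
    α ^ 2 * (1 - |a|) ≤ 4 * e ^ 2 := by
  have hb2 : b ^ 2 ≤ 1 := by simpa using (sq_le_one_iff_abs_le_one b).2 hb
  have h1 : α * (α - 2 * h) * (1 - a ^ 2) + 2 * h ^ 2 ≤ 2 * e ^ 2 := by
    have : 0 ≤ α * (α - 2 * h) * (1 - b ^ 2) :=
      mul_nonneg (mul_nonneg hα.le (by linarith)) (by linarith)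
    nlinarith
  have h2 : α ^ 2 * (1 - (a ^ 2) ^ 2) ≤ 4 * e ^ 2 := by
    nlinarith [sq_nonneg (2 * h - α * (1 - a ^ 2))]
  have h3 : (a ^ 2) ^ 2 ≤ |a| := by
    rw [← sq_abs a, ← pow_mul]
    exact pow_le_of_le_one (abs_nonneg a) ha (by norm_num)
  nlinarith [mul_nonneg (sq_nonneg α) (sub_nonneg.2 h3)]

/-- **Perturbation of eigenfunctions (Lemma 3.2 of Hörmann–Kokoszka).**
Let `C` and `K` be compact operators on a separable Hilbert space `H` with singular value
decompositions `C x = ∑ⱼ λⱼ ⟪x, vⱼ⟫ vⱼ` and `K x = ∑ⱼ γⱼ ⟪x, uⱼ⟫ gⱼ`.  Assume `C` is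
Hilbert–Schmidt (`∑ λⱼ² < ∞`), symmetric and positive definite, so that the `vⱼ` are its
eigenfunctions, and that its eigenvalues (indexed here from `0`, so that `lam j` is the
`(j+1)`-st eigenvalue `λ_{j+1}`) satisfy `λ₁ > λ₂ > ⋯ > λ_d > λ_{d+1}`.  Then for `1 ≤ j ≤ d`
(here `j < d` with the `0`-indexing), with `v'ⱼ = sign ⟪uⱼ, vⱼ⟫ • vⱼ`,
`‖uⱼ - v'ⱼ‖ ≤ (2√2 / αⱼ) ‖K - C‖`, where `α₁ = λ₁ - λ₂` and
`αⱼ = min (λ_{j-1} - λⱼ) (λⱼ - λ_{j+1})` for `2 ≤ j ≤ d`. -/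
theorem eigenfunction_perturbation
    {H : Type} [NormedAddCommGroup H] [InnerProductSpace ℝ H] [CompleteSpace H]
    [SecondCountableTopology H]
    (C K : H →L[ℝ] H) (hC : IsCompactOperator C) (hK : IsCompactOperator K)
    (lam gam : ℕ → ℝ) (v u g : ℕ → H)
    (hlam_nonneg : ∀ j, 0 ≤ lam j) (hgam_nonneg : ∀ j, 0 ≤ gam j)
    (hlam_dec : Antitone lam) (hgam_dec : Antitone gam)
    (hv : Orthonormal ℝ v) (hu : Orthonormal ℝ u) (hg : Orthonormal ℝ g)
    (hCsvd : ∀ x, HasSum (fun j => (lam j * ⟪x, v j⟫) • v j) (C x))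
    (hKsvd : ∀ x, HasSum (fun j => (gam j * ⟪x, u j⟫) • g j) (K x))
    -- `C` is Hilbert–Schmidt, symmetric, positive definite:
    (hHS : Summable fun j => lam j ^ 2)
    (hsymm : ∀ x y, ⟪C x, y⟫ = ⟪x, C y⟫)
    (hpos : ∀ x, x ≠ 0 → 0 < ⟪C x, x⟫)
    (heig : ∀ j, C (v j) = lam j • v j)
    -- the eigenvalues `λ₁ > λ₂ > ⋯ > λ_d > λ_{d+1}`:
    (d : ℕ) (hgap : ∀ j, j < d → lam (j + 1) < lam j) :
    ∀ j, j < d →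
      ‖u j - Real.sign ⟪u j, v j⟫ • v j‖ ≤
        2 * Real.sqrt 2 /
            (if j = 0 then lam 0 - lam 1 else min (lam (j - 1) - lam j) (lam j - lam (j + 1))) *
          ‖K - C‖ := by
  intro j hj
  set α := if j = 0 then lam 0 - lam 1 else min (lam (j - 1) - lam j) (lam j - lam (j + 1))
    with hαdef
  have hα : 0 < α := by
    rw [hαdef]
    split_ifs with h0
    · have := hgap 0 (by omega)
      simpa using this
    · have h1 := hgap (j - 1) (by omega)
      rw [Nat.sub_add_cancel (by omega)] at h1
      exact lt_min (by linarith) (by linarith [hgap j hj])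
  have hsep : ∀ i, i ≠ j → α ≤ |lam i - lam j| := by
    have hbelow : α ≤ lam j - lam (j + 1) := by
      rw [hαdef]
      split_ifs with h0
      · simp [h0]
      · exact min_le_right _ _
    intro i hi
    rcases lt_or_gt_of_ne hi with h | h
    · have hle : α ≤ lam (j - 1) - lam j := by
        rw [hαdef, if_neg (by omega)]
        exact min_le_left _ _
      have := hlam_dec (show i ≤ j - 1 by omega)
      exact le_trans (by linarith) (le_abs_self _)
    · have := hlam_dec (show j + 1 ≤ i by omega)
      exact le_trans (by linarith) (neg_le_abs _)
  set e := ‖K - C‖ with he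
  have he0 : 0 ≤ e := norm_nonneg _
  have hunit := norm_sub_sign_smul_sq_le (hu.1 j) (hv.1 j)
  suffices hmain : α ^ 2 * (1 - |⟪u j, v j⟫|) ≤ 4 * e ^ 2 by
    apply le_of_sq_le_sq _ (by positivity)
    refine hunit.trans ?_
    rw [mul_pow, div_pow, mul_pow, Real.sq_sqrt (by norm_num), div_mul_eq_mul_div,
      le_div_iff₀ (by positivity)]
    linarith
  rcases le_or_gt α (2 * e) with hcase | hcase
  · nlinarith [mul_nonneg (sq_nonneg α) (abs_nonneg ⟪u j, v j⟫)]
  have hshift : |gam j - lam j| ≤ e := by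
    have h1 := singular_value_le_add_norm_sub hgam_nonneg hlam_nonneg hgam_dec hlam_dec
      hu hg hv hv hKsvd hCsvd j
    have h2 := singular_value_le_add_norm_sub hlam_nonneg hgam_nonneg hlam_dec hgam_dec
      hv hv hu hg hCsvd hKsvd j
    rw [norm_sub_rev] at h2
    rw [abs_le]
    constructor <;> linarith
  have hbot : (Submodule.span ℝ (Set.range v))ᗮ = ⊥ := by
    rw [Submodule.eq_bot_iff]
    intro x hx
    by_contra hx0
    have hxv : ∀ i, ⟪x, v i⟫ = 0 := fun i =>
      (Submodule.mem_orthogonal' _ x).1 hx _ (Submodule.subset_span ⟨i, rfl⟩)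
    have hCx : C x = 0 := (hCsvd x).unique (by simp [hxv, hasSum_zero])
    simpa [hCx] using hpos x hx0
  let b := HilbertBasis.mkOfOrthogonalEqBot hv hbot
  have hparseval : ∀ x : H, HasSum (fun i => ⟪x, v i⟫ ^ 2) (‖x‖ ^ 2) := fun x => by
    have h := b.hasSum_inner_mul_inner x x
    rw [real_inner_self_eq_norm_sq] at h
    refine h.congr_fun ?_
    intro i
    simp [b, real_inner_comm, sq]
  have hp : ‖C (g j) - gam j • u j‖ ≤ e := by
    have hKg : C (g j) - gam j • u j = ContinuousLinearMap.adjoint (C - K) (g j) := by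
      refine ext_inner_left ℝ fun x => ?_
      rw [ContinuousLinearMap.adjoint_inner_right, inner_sub_right, inner_smul_right,
        sub_apply, inner_sub_left, inner_apply_of_svd hg hKsvd, hsymm]
    rw [hKg]
    refine (ContinuousLinearMap.le_opNorm _ _).trans ?_
    rw [LinearIsometryEquiv.norm_map, hg.1 j, mul_one, norm_sub_rev]
  have hr : ‖C (u j) - gam j • g j‖ ≤ e := by
    rw [← apply_right_singular_vector hu hKsvd, ← sub_apply]
    refine (ContinuousLinearMap.le_opNorm _ _).trans ?_
    rw [hu.1 j, mul_one, norm_sub_rev]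
  have hcoord : ∀ x y i, ⟪C x - gam j • y, v i⟫ = lam i * ⟪x, v i⟫ - gam j * ⟪y, v i⟫ := by
    intro x y i
    rw [inner_sub_left, hsymm, heig, inner_smul_right, real_inner_smul_left]
  have hsum1 := (hparseval (C (g j) - gam j • u j)).add (hparseval (C (u j) - gam j • g j))
  simp only [hcoord] at hsum1
  set h := |gam j - lam j| with hhdef
  have hsum2 := (((hparseval (u j)).add (hparseval (g j))).mul_left ((α - h) ^ 2)).add
    (hasSum_ite_eq j ((h ^ 2 - (α - h) ^ 2) * (⟪u j, v j⟫ ^ 2 + ⟪g j, v j⟫ ^ 2)))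
  have hle := hasSum_le (fun i => by
    by_cases hi : i = j
    · subst hi
      have := sq_dist_mul_le_residuals (a := ⟪u i, v i⟫) (b := ⟪g i, v i⟫)
        (hlam_nonneg i) (hgam_nonneg i) (abs_nonneg _) (abs_sub_comm (gam i) (lam i)).le
      simp only [if_true]
      linarith
    · have htri : α - h ≤ |lam i - gam j| := by
        have h1 := abs_sub_le (lam i) (gam j) (lam j)
        linarith [hsep i hi]
      have := sq_dist_mul_le_residuals (a := ⟪u j, v i⟫) (b := ⟪g j, v i⟫)
        (hlam_nonneg i) (hgam_nonneg j) (by linarith) htri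
      simpa [hi] using this) hsum2 hsum1
  have hcos : ∀ x : H, ‖x‖ = 1 → |⟪x, v j⟫| ≤ 1 := fun x hx => by
    simpa [hx, hv.1 j] using abs_real_inner_le_norm x (v j)
  refine one_sub_le_of_gap_bound (h := h) (b := ⟪g j, v j⟫) hα (by linarith)
    (hcos _ (hu.1 j)) (hcos _ (hg.1 j)) ?_
  have hp2 : ‖C (g j) - gam j • u j‖ ^ 2 ≤ e ^ 2 := by gcongr
  have hr2 : ‖C (u j) - gam j • g j‖ ^ 2 ≤ e ^ 2 := by gcongr
  rw [hu.1 j, hg.1 j] at hle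
  linarith
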